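/- A λ-accessible monad on a locally λ-presentable category has a locally λ-presentable category of Eilenberg–Moore algebras. -/

import Mathlib

open CategoryTheory CategoryTheory.Limits

universe v u

/-- A small category `A` is `κ`-small if it has fewer than `κ` morphisms. -/
def KappaSmall (κ : Cardinal.{v}) (A : Type v) [SmallCategory A] : Prop :=
  Cardinal.mk (Σ a b : A, a ⟶ b) < κ

/-- A small category `J` is `κ`-filtered if every diagram in `J` indexed by a
`κ`-small category admits a cocone. -/
def KappaFiltered (κ : Cardinal.{v}) (J : Type v) [SmallCategory J] : Prop :=
  ∀ (A : Type v) (_ : SmallCategory A), KappaSmall κ A →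
    ∀ (F : A ⥤ J), Nonempty (Cocone F)

/-- An object `X` is `κ`-presentable if its covariant hom-functor preserves colimits of
`κ`-filtered shapes. -/
def KappaPresentable (κ : Cardinal.{v}) {C : Type u} [Category.{v} C] (X : C) : Prop :=
  ∀ (J : Type v) (_ : SmallCategory J), KappaFiltered κ J →
    Nonempty (PreservesColimitsOfShape J (coyoneda.obj (Opposite.op X)))

/-- A category is locally `κ`-presentable if it is cocomplete and possesses a small
family of `κ`-presentable objects such that every object is a `κ`-filtered colimit of
objects of the family. -/
def LocallyKappaPresentable (κ : Cardinal.{v}) (C : Type u) [Category.{v} C] : Prop :=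
  HasColimits C ∧
    ∃ S : Set C, Small.{v} S ∧ (∀ X ∈ S, KappaPresentable κ X) ∧
      ∀ X : C, ∃ (J : Type v) (_ : SmallCategory J) (F : J ⥤ C) (c : Cocone F),
        KappaFiltered κ J ∧ (∀ j, F.obj j ∈ S) ∧ Nonempty (IsColimit c) ∧ c.pt = X

lemma kappaSmall_iff (κ : Cardinal.{v}) (A : Type v) [SmallCategory A] :
    KappaSmall κ A ↔ HasCardinalLT (Arrow A) κ := by
  let e : Arrow A ≃ Σ a b : A, a ⟶ b :=
    { toFun f := ⟨f.left, f.right, f.hom⟩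
      invFun f := Arrow.mk f.2.2
      left_inv _ := rfl
      right_inv _ := rfl }
  rw [hasCardinalLT_iff_of_equiv e, hasCardinalLT_iff_cardinal_mk_lt, KappaSmall]

lemma kappaFiltered_iff (κ : Cardinal.{v}) [Fact κ.IsRegular] (J : Type v) [SmallCategory J] :
    KappaFiltered κ J ↔ IsCardinalFiltered J κ :=
  ⟨fun h ↦ ⟨fun {A} _ F hA ↦ h A _ ((kappaSmall_iff κ A).2 hA) F⟩,
    fun h A _ hA F ↦ h.nonempty_cocone F ((kappaSmall_iff κ A).1 hA)⟩

lemma kappaPresentable_iff (κ : Cardinal.{v}) [Fact κ.IsRegular] {C : Type u} [Category.{v} C]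
    (X : C) : KappaPresentable κ X ↔ IsCardinalPresentable X κ := by
  refine ⟨fun h ↦ ⟨fun J _ hJ ↦ (h J _ ((kappaFiltered_iff κ J).2 hJ)).some⟩, fun h J _ hJ ↦ ?_⟩
  have := (kappaFiltered_iff κ J).1 hJ
  exact ⟨preservesColimitsOfShape_of_isCardinalPresentable X κ J⟩

lemma locallyKappaPresentable_iff (κ : Cardinal.{v}) [Fact κ.IsRegular] (C : Type u)
    [Category.{v} C] : LocallyKappaPresentable κ C ↔ IsCardinalLocallyPresentable C κ := by
  constructor
  · rintro ⟨_, S, hS, hp, h⟩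
    let P : ObjectProperty C := fun X ↦ X ∈ S
    have : ObjectProperty.Small.{v} P := hS
    have hP : P.IsCardinalFilteredGenerator κ :=
      { le_isCardinalPresentable X hX := (kappaPresentable_iff κ X).1 (hp X hX)
        exists_colimitsOfShape X := by
          obtain ⟨J, _, F, c, hJ, hF, ⟨hc⟩, rfl⟩ := h X
          exact ⟨J, _, (kappaFiltered_iff κ J).1 hJ,
            ⟨{ diag := F, ι := c.ι, isColimit := hc, prop_diag_obj := hF }⟩⟩ }
    have := hP.hasCardinalFilteredGenerator
    constructor
  · intro _
    obtain ⟨P, _, hP⟩ := HasCardinalFilteredGenerator.exists_small_generator C κ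
    refine ⟨inferInstance, {X | P X}, inferInstanceAs (ObjectProperty.Small.{v} P),
      fun X hX ↦ (kappaPresentable_iff κ X).2 (hP.le_isCardinalPresentable X hX), fun X ↦ ?_⟩
    obtain ⟨J, _, hJ, ⟨p⟩⟩ := hP.exists_colimitsOfShape X
    exact ⟨J, _, p.diag, _, (kappaFiltered_iff κ J).2 hJ, p.prop_diag_obj, ⟨p.isColimit⟩, rfl⟩

lemma comma_hasColimitsOfShape {A T J : Type*} [Category* A] [Category* T] [Category* J]
    (L : A ⥤ T) [HasColimitsOfShape J A] [HasColimitsOfShape J T] [HasPushouts T] :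
    HasColimitsOfShape J (Comma L (𝟭 T)) where
  has_colimit F := by
    let X := F ⋙ Comma.fst L (𝟭 T)
    let Y := F ⋙ Comma.snd L (𝟭 T)
    let α : X ⋙ L ⟶ Y := Functor.whiskerLeft F (Comma.natTrans L (𝟭 T))
    let f : colimit (X ⋙ L) ⟶ L.obj (colimit X) := colimit.post X L
    let g : colimit (X ⋙ L) ⟶ colimit Y := colimMap α
    let c : Cocone F :=
      { pt := ⟨colimit X, pushout f g, pushout.inl f g⟩
        ι :=
          { app j :=
              { left := colimit.ι X j
                right := colimit.ι Y j ≫ pushout.inr f g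
                w := by
                  have h₁ : colimit.ι (X ⋙ L) j ≫ f = L.map (colimit.ι X j) := colimit.ι_post X L j
                  have h₂ : colimit.ι (X ⋙ L) j ≫ g = (F.obj j).hom ≫ colimit.ι Y j :=
                    ι_colimMap α j
                  change L.map (colimit.ι X j) ≫ pushout.inl f g =
                    (F.obj j).hom ≫ colimit.ι Y j ≫ pushout.inr f g
                  rw [← h₁, ← reassoc_of% h₂, Category.assoc, pushout.condition] }
            naturality i j t := by
              ext
              · change X.map t ≫ colimit.ι X j = colimit.ι X i ≫ 𝟙 _
                simp
              · change Y.map t ≫ colimit.ι Y j ≫ pushout.inr f g =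
                  (colimit.ι Y i ≫ pushout.inr f g) ≫ 𝟙 _
                simp } }
    let sX (s : Cocone F) : Cocone X := (Comma.fst L (𝟭 T)).mapCocone s
    let sY (s : Cocone F) : Cocone Y := (Comma.snd L (𝟭 T)).mapCocone s
    have hs (s : Cocone F) : f ≫ L.map (colimit.desc X (sX s)) ≫ s.pt.hom =
        g ≫ colimit.desc Y (sY s) := by
      refine colimit.hom_ext fun j ↦ ?_
      have h₁ : colimit.ι (X ⋙ L) j ≫ f = L.map (colimit.ι X j) := colimit.ι_post X L j
      have h₂ : colimit.ι (X ⋙ L) j ≫ g = (F.obj j).hom ≫ colimit.ι Y j := ι_colimMap α j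
      rw [reassoc_of% h₁, reassoc_of% h₂, colimit.ι_desc, ← L.map_comp_assoc, colimit.ι_desc]
      exact (s.ι.app j).w
    exact ⟨⟨c,
      { desc s :=
          { left := colimit.desc X (sX s)
            right := pushout.desc (L.map (colimit.desc X (sX s)) ≫ s.pt.hom)
              (colimit.desc Y (sY s)) (hs s)
            w := (pushout.inl_desc _ _ _).symm }
        fac s j := by
          ext
          · exact colimit.ι_desc (sX s) j
          · change (colimit.ι Y j ≫ pushout.inr f g) ≫ pushout.desc _ _ _ = _
            rw [Category.assoc, pushout.inr_desc]
            exact colimit.ι_desc (sY s) j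
        uniq s m hm := by
          have hl : m.left = colimit.desc X (sX s) := colimit.hom_ext fun j ↦ by
            rw [colimit.ι_desc]
            exact congr_arg CommaMorphism.left (hm j)
          have hr : pushout.inl f g ≫ m.right = L.map m.left ≫ s.pt.hom := m.w.symm
          refine CommaMorphism.ext hl ?_
          refine pushout.hom_ext ?_ ?_
          · rw [pushout.inl_desc, hr, hl]
          · rw [pushout.inr_desc]
            refine colimit.hom_ext fun j ↦ ?_
            rw [colimit.ι_desc, ← Category.assoc]
            exact congr_arg CommaMorphism.right (hm j) }⟩⟩

lemma comma_isCardinalPresentable {A B T : Type u} [Category.{v} A] [Category.{v} B]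
    [Category.{v} T] {L : A ⥤ T} {R : B ⥤ T} (κ : Cardinal.{v}) [Fact κ.IsRegular]
    [HasCardinalFilteredColimits.{v} A κ] [HasCardinalFilteredColimits.{v} B κ]
    [L.IsCardinalAccessible κ] [R.IsCardinalAccessible κ] (X : Comma L R)
    [IsCardinalPresentable X.left κ] [IsCardinalPresentable X.right κ]
    [IsCardinalPresentable (L.obj X.left) κ] : IsCardinalPresentable X κ := by
  refine ⟨fun J _ _ ↦ ⟨fun {F} ↦ ⟨fun {c} hc ↦ ?_⟩⟩⟩
  have := isFiltered_of_isCardinalFiltered J κ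
  have := HasCardinalFilteredColimits.hasColimitsOfShape A κ J
  have := HasCardinalFilteredColimits.hasColimitsOfShape B κ J
  have := L.preservesColimitsOfShape_of_isCardinalAccessible κ J
  have := R.preservesColimitsOfShape_of_isCardinalAccessible κ J
  have hl := isColimitOfPreserves (Comma.fst L R) hc
  have hr := isColimitOfPreserves (Comma.snd L R) hc
  have hRr := isColimitOfPreserves R hr
  refine ⟨Types.FilteredColimit.isColimitOf' _ _ (fun f ↦ ?_) fun j f g hfg ↦ ?_⟩
  · obtain ⟨i, a, ha⟩ := IsCardinalPresentable.exists_hom_of_isColimit κ hl f.left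
    obtain ⟨i', b, hb⟩ := IsCardinalPresentable.exists_hom_of_isColimit κ hr f.right
    let j := IsFiltered.max i i'
    let a' : X.left ⟶ (F.obj j).left := a ≫ (F.map (IsFiltered.leftToMax i i')).left
    let b' : X.right ⟶ (F.obj j).right := b ≫ (F.map (IsFiltered.rightToMax i i')).right
    have ha' : a' ≫ (c.ι.app j).left = f.left := by
      rw [← ha, Category.assoc]
      exact a ≫= congr_arg CommaMorphism.left (c.w (IsFiltered.leftToMax i i'))
    have hb' : b' ≫ (c.ι.app j).right = f.right := by
      rw [← hb, Category.assoc]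
      exact b ≫= congr_arg CommaMorphism.right (c.w (IsFiltered.rightToMax i i'))
    obtain ⟨k, t, ht⟩ := IsCardinalPresentable.exists_eq_of_isColimit' κ hRr
      (L.map a' ≫ (F.obj j).hom) (X.hom ≫ R.map b') (by
        change (L.map a' ≫ (F.obj j).hom) ≫ R.map (c.ι.app j).right =
          (X.hom ≫ R.map b') ≫ R.map (c.ι.app j).right
        rw [Category.assoc, Category.assoc, ← (c.ι.app j).w, ← L.map_comp_assoc, ha',
          ← R.map_comp, hb']
        exact f.w)
    replace ht : (L.map a' ≫ (F.obj j).hom) ≫ R.map (F.map t).right =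
      (X.hom ≫ R.map b') ≫ R.map (F.map t).right := ht
    refine ⟨k, { left := a' ≫ (F.map t).left, right := b' ≫ (F.map t).right, w := ?_ }, ?_⟩
    · rw [L.map_comp, Category.assoc, (F.map t).w, R.map_comp, ← Category.assoc, ht,
        Category.assoc]
    · refine (CommaMorphism.ext ?_ ?_).symm
      · change (a' ≫ (F.map t).left) ≫ (c.ι.app k).left = _
        rw [Category.assoc, ← ha']
        exact a' ≫= congr_arg CommaMorphism.left (c.w t)
      · change (b' ≫ (F.map t).right) ≫ (c.ι.app k).right = _
        rw [Category.assoc, ← hb']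
        exact b' ≫= congr_arg CommaMorphism.right (c.w t)
  · obtain ⟨i, s, hs⟩ := IsCardinalPresentable.exists_eq_of_isColimit' κ hl f.left g.left
      (congr_arg CommaMorphism.left hfg)
    obtain ⟨i', s', hs'⟩ := IsCardinalPresentable.exists_eq_of_isColimit' κ hr f.right g.right
      (congr_arg CommaMorphism.right hfg)
    let k := IsFiltered.coeq (s ≫ IsFiltered.leftToMax i i') (s' ≫ IsFiltered.rightToMax i i')
    let p := IsFiltered.coeqHom (s ≫ IsFiltered.leftToMax i i') (s' ≫ IsFiltered.rightToMax i i')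
    have hp := IsFiltered.coeq_condition (s ≫ IsFiltered.leftToMax i i')
      (s' ≫ IsFiltered.rightToMax i i')
    refine ⟨k, (s ≫ IsFiltered.leftToMax i i') ≫ p, CommaMorphism.ext ?_ ?_⟩
    · change f.left ≫ ((F ⋙ Comma.fst L R).map _) = g.left ≫ ((F ⋙ Comma.fst L R).map _)
      rw [Category.assoc, Functor.map_comp, ← Category.assoc, ← Category.assoc]
      exact hs =≫ _
    · change f.right ≫ ((F ⋙ Comma.snd L R).map _) = g.right ≫ ((F ⋙ Comma.snd L R).map _)
      rw [hp, Category.assoc, Functor.map_comp, ← Category.assoc, ← Category.assoc]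
      exact hs' =≫ _

lemma isIso_of_isStrongGenerator {C : Type*} [Category* C] {P : ObjectProperty C}
    (hP : P.IsStrongGenerator) {X Y : C} (f : X ⟶ Y)
    (hf : ∀ G, P G → Function.Bijective fun x : G ⟶ X ↦ x ≫ f) : IsIso f := by
  have : Mono f := (hP.isSeparating.mono_iff f).2 fun G hG _ _ h ↦ (hf G hG).1 h
  exact hP.isIso_of_mono f fun G hG ↦ (hf G hG).2

lemma isStrongGenerator_strictMap_leftAdjoint {C D : Type*} [Category* C] [Category* D]
    {P : ObjectProperty C} (hP : P.IsStrongGenerator) {F : C ⥤ D} {G : D ⥤ C} (adj : F ⊣ G)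
    [G.Faithful] [G.ReflectsIsomorphisms] : (P.strictMap F).IsStrongGenerator := by
  have := adj.isRightAdjoint
  refine ObjectProperty.isStrongGenerator_iff.2 ⟨fun X Y f g h ↦ G.map_injective ?_,
    fun X Y i _ hi ↦ ?_⟩
  · refine hP.isSeparating _ _ fun Z hZ x ↦ (adj.homEquiv _ _).symm.injective ?_
    rw [adj.homEquiv_naturality_right_symm, adj.homEquiv_naturality_right_symm]
    exact h _ ⟨Z, hZ⟩ _
  · have : IsIso (G.map i) := hP.isIso_of_mono _ fun Z hZ y ↦ by
      obtain ⟨x, hx⟩ := hi _ ⟨Z, hZ⟩ ((adj.homEquiv _ _).symm y)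
      refine ⟨adj.homEquiv _ _ x, ?_⟩
      change adj.homEquiv _ _ x ≫ G.map i = y
      rw [← adj.homEquiv_naturality_right]
      exact (Equiv.eq_symm_apply _).1 hx
    exact isIso_of_reflects_iso i G

lemma exists_isCardinalPresentable {C : Type u} [Category.{v} C] (κ : Cardinal.{v})
    {ι : Type*} [Small.{v} ι] (X : ι → C) [∀ i, IsPresentable.{v} (X i)] :
    ∃ (κ' : Cardinal.{v}) (_ : Fact κ'.IsRegular), κ ≤ κ' ∧
      ∀ i, IsCardinalPresentable (X i) κ' := by
  choose c hc hX using fun i ↦ Functor.IsAccessible.exists_cardinal.{v}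
    (F := coyoneda.obj (Opposite.op (X i)))
  obtain ⟨κ', h₁, h₂⟩ := HasCardinalLT.exists_regular_cardinal_forall.{v}
    (Sum.elim (fun _ : Unit ↦ κ.ord.ToType) fun i ↦ (c i).ord.ToType)
  have : Fact κ'.IsRegular := ⟨h₁⟩
  refine ⟨κ', this, le_of_lt (by simpa [hasCardinalLT_iff_cardinal_mk_lt] using h₂ (Sum.inl ⟨⟩)),
    fun i ↦ ?_⟩
  have : IsCardinalPresentable (X i) (c i) := hX i
  exact isCardinalPresentable_of_le (X i)
    (le_of_lt (by simpa [hasCardinalLT_iff_cardinal_mk_lt] using h₂ (Sum.inr i)))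

lemma algebra_isCardinalLocallyPresentable_of_hasColimits {C : Type u} [Category.{v} C]
    (κ : Cardinal.{v}) [Fact κ.IsRegular] [IsCardinalLocallyPresentable C κ] (M : Monad C)
    [M.toFunctor.IsCardinalAccessible κ] [HasColimits M.Algebra] :
    IsCardinalLocallyPresentable M.Algebra κ := by
  obtain ⟨P, _, hP⟩ := HasCardinalFilteredGenerator.exists_small_generator C κ
  have : M.forget.IsCardinalAccessible κ := ⟨fun J _ _ ↦
    have := M.toFunctor.preservesColimitsOfShape_of_isCardinalAccessible κ J
    inferInstance⟩
  refine (IsCardinalLocallyPresentable.iff_exists_isStrongGenerator _ κ).2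
    ⟨P.strictMap M.free, inferInstance,
      isStrongGenerator_strictMap_leftAdjoint hP.isStrongGenerator M.adj, ?_⟩
  rintro _ ⟨X, hX⟩
  have : IsCardinalPresentable X κ := hP.le_isCardinalPresentable X hX
  exact M.adj.isCardinalPresentable_leftAdjoint_obj κ X

section

variable {C : Type u} [Category.{v} C] (M : Monad C)

lemma monad_unit_map_assoc {X Y Z : C} (x : X ⟶ Y) (y : M.obj Y ⟶ Z) :
    M.η.app X ≫ M.map x ≫ y = x ≫ M.η.app Y ≫ y :=
  (M.η.naturality_assoc x y).symm

lemma monad_mul_map_assoc {X Y Z : C} (x : X ⟶ Y) (y : M.obj Y ⟶ Z) :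
    M.map (M.map x) ≫ M.μ.app Y ≫ y = M.μ.app X ≫ M.map x ≫ y :=
  M.μ.naturality_assoc x y

/-- The object of `Comma M.toFunctor (𝟭 C)` given by a morphism `y : M.obj X ⟶ Y`. -/
abbrev commaObj {X Y : C} (y : M.obj X ⟶ Y) : Comma M.toFunctor (𝟭 C) :=
  Comma.mk X Y y

variable {M} in
/-- Constructor for morphisms in `Comma M.toFunctor (𝟭 C)`. -/
abbrev commaHomMk {X Y X' Y' : C} {y : M.obj X ⟶ Y} {y' : M.obj X' ⟶ Y'} (l : X ⟶ X') (r : Y ⟶ Y')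
    (w : M.map l ≫ y' = y ≫ r) : commaObj M y ⟶ commaObj M y' :=
  { left := l, right := r, w := w }

/-- The functor which sends an algebra to its structure morphism. -/
def algebraToComma : M.Algebra ⥤ Comma M.toFunctor (𝟭 C) where
  obj A := commaObj M A.a
  map f := commaHomMk f.f f.f f.h

instance : (algebraToComma M).Faithful where
  map_injective h := Monad.Algebra.Hom.ext (congr_arg CommaMorphism.left h)

instance : (algebraToComma M).Full where
  map_surjective {A B} f := by
    let l : A.A ⟶ B.A := f.left
    let r : A.A ⟶ B.A := f.right
    have w : M.map l ≫ B.a = A.a ≫ r := f.w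
    have h : l = r := by
      have := M.η.app A.A ≫= w
      rwa [monad_unit_map_assoc, B.unit, Category.comp_id, reassoc_of% A.unit] at this
    exact ⟨{ f := l, h := by rw [w, h] }, CommaMorphism.ext rfl h⟩

/-- Morphisms from the identity of `M.obj G` in the comma category. -/
def commaHomIdEquiv (G : C) {X Y : C} (y : M.obj X ⟶ Y) :
    (commaObj M (𝟙 (M.obj G)) ⟶ commaObj M y) ≃ (G ⟶ X) where
  toFun g := g.left
  invFun x := commaHomMk x (M.map x ≫ y) (Category.id_comp _).symm
  left_inv g := CommaMorphism.ext rfl (g.w.trans (Category.id_comp _))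
  right_inv _ := rfl

/-- A morphism in the comma category expressing the associativity of algebra structures. -/
def commaMulHom (G : C) : commaObj M (𝟙 (M.obj G)) ⟶ commaObj M (M.μ.app G) :=
  commaHomMk (M.η.app G) (𝟙 _) ((M.right_unit G).trans (Category.comp_id _).symm)

lemma exists_of_surjective_commaMulHom {G X Y : C} (y : M.obj X ⟶ Y)
    (hy : Function.Surjective fun g : commaObj M (M.μ.app G) ⟶ commaObj M y ↦ commaMulHom M G ≫ g)
    (x : G ⟶ X) : ∃ h : M.obj G ⟶ X, M.map h ≫ y = M.μ.app G ≫ M.map x ≫ y := by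
  obtain ⟨g, hg⟩ := hy ((commaHomIdEquiv M G y).symm x)
  have hr : 𝟙 (M.obj G) ≫ g.right = M.map x ≫ y := congr_arg CommaMorphism.right hg
  refine ⟨g.left, ?_⟩
  rw [← hr, Category.id_comp]
  exact g.w

lemma bijective_commaMulHom_algebra (G : C) (A : M.Algebra) :
    Function.Bijective
      fun g : commaObj M (M.μ.app G) ⟶ commaObj M A.a ↦ commaMulHom M G ≫ g := by
  have h_left (g : commaObj M (M.μ.app G) ⟶ commaObj M A.a) : g.left = g.right := by
    have h : M.map g.left ≫ A.a = M.μ.app G ≫ g.right := g.w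
    replace h := M.η.app (M.obj G) ≫= h
    rwa [monad_unit_map_assoc, A.unit, Category.comp_id, ← Category.assoc, M.left_unit,
      Category.id_comp] at h
  refine ⟨fun g g' h ↦ ?_, fun g ↦ ?_⟩
  · have hr : g.right = g'.right := by
      have : 𝟙 (M.obj G) ≫ g.right = 𝟙 (M.obj G) ≫ g'.right := congr_arg CommaMorphism.right h
      rwa [Category.id_comp, Category.id_comp] at this
    exact CommaMorphism.ext (by rw [h_left, h_left, hr]) hr
  · obtain ⟨x, rfl⟩ := (commaHomIdEquiv M G A.a).symm.surjective g
    refine ⟨commaHomMk (M.map x ≫ A.a) (M.map x ≫ A.a) ?_, CommaMorphism.ext ?_ ?_⟩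
    · rw [M.map_comp, Category.assoc, ← A.assoc, monad_mul_map_assoc]
    · change M.η.app G ≫ M.map x ≫ A.a = x
      rw [monad_unit_map_assoc, A.unit, Category.comp_id]
    · exact Category.id_comp _

section

variable [HasInitial C] [HasBinaryCoproducts C]

/-- Morphisms to a given object in the comma category from a coproduct injection. -/
noncomputable def commaHomInlEquiv (G : C) {X Y : C} (y : M.obj X ⟶ Y) :
    (commaObj M (coprod.inl : M.obj (⊥_ C) ⟶ M.obj (⊥_ C) ⨿ G) ⟶ commaObj M y) ≃ (G ⟶ Y) where
  toFun g := coprod.inr ≫ g.right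
  invFun x := commaHomMk (initial.to X) (coprod.desc (M.map (initial.to X) ≫ y) x)
    (coprod.inl_desc _ _).symm
  left_inv g := by
    have hl : initial.to X = g.left := initialIsInitial.hom_ext _ _
    refine CommaMorphism.ext hl (coprod.hom_ext ?_ ?_)
    · refine (coprod.inl_desc _ _).trans ?_
      rw [hl]
      exact g.w
    · exact coprod.inr_desc _ _
  right_inv _ := coprod.inr_desc _ _

/-- A morphism in the comma category which detects the objects `y : M.obj X ⟶ Y` for which
postcomposition with `M.η.app X ≫ y` is bijective on morphisms from `G`. -/
noncomputable def commaUnitHom (G : C) :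
    commaObj M (coprod.inl : M.obj (⊥_ C) ⟶ M.obj (⊥_ C) ⨿ G) ⟶ commaObj M (𝟙 (M.obj G)) :=
  commaHomMk (initial.to G) (coprod.desc (M.map (initial.to G)) (M.η.app G))
    ((Category.comp_id _).trans (coprod.inl_desc _ _).symm)

lemma bijective_commaUnitHom_iff (G : C) {X Y : C} (y : M.obj X ⟶ Y) :
    (Function.Bijective
      fun g : commaObj M (𝟙 (M.obj G)) ⟶ commaObj M y ↦ commaUnitHom M G ≫ g) ↔
      Function.Bijective fun x : G ⟶ X ↦ x ≫ M.η.app X ≫ y := by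
  rw [← Function.Bijective.of_comp_iff' (commaHomInlEquiv M G y).bijective,
    ← Function.Bijective.of_comp_iff _ (commaHomIdEquiv M G y).symm.bijective]
  refine iff_of_eq (congr_arg _ (funext fun x ↦ ?_))
  change coprod.inr ≫ coprod.desc (M.map (initial.to G)) (M.η.app G) ≫ M.map x ≫ y = _
  rw [coprod.inr_desc_assoc, monad_unit_map_assoc]

end

end

lemma hom_ext_of_isCardinalFilteredGenerator {C D : Type*} [Category.{v} C] [Category* D]
    {κ : Cardinal.{v}} [Fact κ.IsRegular] {P : ObjectProperty C}
    (hP : P.IsCardinalFilteredGenerator κ) (F : C ⥤ D) [F.IsCardinalAccessible κ] {X : C} {Z : D}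
    {f g : F.obj X ⟶ Z}
    (h : ∀ (G : C) (_ : P G) (x : G ⟶ X), F.map x ≫ f = F.map x ≫ g) : f = g := by
  obtain ⟨J, _, _, ⟨p⟩⟩ := hP.exists_colimitsOfShape X
  have := F.preservesColimitsOfShape_of_isCardinalAccessible κ J
  exact (isColimitOfPreserves F p.isColimit).hom_ext fun j ↦ h _ (p.prop_diag_obj j) (p.ι.app j)

lemma exists_algebra_iso_commaObj {C : Type u} [Category.{v} C] (M : Monad C)
    {κ : Cardinal.{v}} [Fact κ.IsRegular] [M.toFunctor.IsCardinalAccessible κ]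
    {P : ObjectProperty C} (hP : P.IsCardinalFilteredGenerator κ) {X Y : C} (y : M.obj X ⟶ Y)
    (h₁ : ∀ G, P G → Function.Bijective fun x : G ⟶ X ↦ x ≫ M.η.app X ≫ y)
    (h₂ : ∀ G, P G → ∀ x : G ⟶ X, ∃ h : M.obj G ⟶ X,
      M.map h ≫ y = M.μ.app G ≫ M.map x ≫ y) :
    ∃ A : M.Algebra, Nonempty ((algebraToComma M).obj A ≅ commaObj M y) := by
  have := isIso_of_isStrongGenerator hP.isStrongGenerator (M.η.app X ≫ y) h₁
  let e := asIso (M.η.app X ≫ y)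
  let a : M.obj X ⟶ X := y ≫ e.inv
  have unit : M.η.app X ≫ a = 𝟙 X := (Category.assoc _ _ _).symm.trans e.hom_inv_id
  have assoc : M.μ.app X ≫ a = M.map a ≫ a := by
    refine hom_ext_of_isCardinalFilteredGenerator hP (M.toFunctor ⋙ M.toFunctor) fun G hG x ↦ ?_
    obtain ⟨h, hh⟩ := h₂ G hG x
    have key : M.map h ≫ a = M.μ.app G ≫ M.map x ≫ a := by
      simp only [a, ← Category.assoc] at hh ⊢
      rw [hh]
    have ha : M.map x ≫ a = h := by
      have := M.η.app (M.obj G) ≫= key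
      rw [monad_unit_map_assoc, unit, Category.comp_id, ← Category.assoc, M.left_unit,
        Category.id_comp] at this
      exact this.symm
    change M.map (M.map x) ≫ M.μ.app X ≫ a =
      M.map (M.map x) ≫ M.map a ≫ a
    rw [monad_mul_map_assoc, ← key, ← M.map_comp_assoc, ha]
  exact ⟨{ A := X, a := a, unit := unit, assoc := assoc },
    ⟨Comma.isoMk (Iso.refl X) e ((congr_arg (· ≫ y) (M.map_id X)).trans
      ((Category.id_comp y).trans (by simp [algebraToComma, a])))⟩⟩

section

variable {C : Type u} [Category.{v} C] [HasInitial C] [HasBinaryCoproducts C]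

/-- The morphisms in the comma category with respect to which the local objects are the
algebras. -/
noncomputable def commaArrow (M : Monad C) (P : ObjectProperty C) :
    Subtype P ⊕ Subtype P → Arrow (Comma M.toFunctor (𝟭 C)) :=
  Sum.elim (fun G ↦ Arrow.mk (commaUnitHom M G.1)) fun G ↦ Arrow.mk (commaMulHom M G.1)

/-- The property of morphisms in the comma category with respect to which the local objects are
the algebras. -/
noncomputable abbrev commaHoms (M : Monad C) (P : ObjectProperty C) :
    MorphismProperty (Comma M.toFunctor (𝟭 C)) :=
  MorphismProperty.ofHoms fun i ↦ (commaArrow M P i).hom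

lemma commaHoms_commaUnitHom (M : Monad C) {P : ObjectProperty C} {G : C} (hG : P G) :
    commaHoms M P (commaUnitHom M G) :=
  .mk (f := fun i ↦ (commaArrow M P i).hom) (Sum.inl ⟨G, hG⟩)

lemma commaHoms_commaMulHom (M : Monad C) {P : ObjectProperty C} {G : C} (hG : P G) :
    commaHoms M P (commaMulHom M G) :=
  .mk (f := fun i ↦ (commaArrow M P i).hom) (Sum.inr ⟨G, hG⟩)

lemma isLocal_commaHoms_algebra (M : Monad C) (P : ObjectProperty C) (A : M.Algebra) :
    (commaHoms M P).isLocal ((algebraToComma M).obj A) := by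
  rintro _ _ _ ⟨G | G⟩
  · refine (bijective_commaUnitHom_iff M G.1 A.a).2 ?_
    simp only [A.unit, Category.comp_id]
    exact Function.bijective_id
  · exact bijective_commaMulHom_algebra M G.1 A

lemma exists_algebra_iso_of_isLocal (M : Monad C) {κ : Cardinal.{v}} [Fact κ.IsRegular]
    [M.toFunctor.IsCardinalAccessible κ] {P : ObjectProperty C}
    (hP : P.IsCardinalFilteredGenerator κ) {Z : Comma M.toFunctor (𝟭 C)}
    (hZ : (commaHoms M P).isLocal Z) :
    ∃ A : M.Algebra, Nonempty ((algebraToComma M).obj A ≅ Z) :=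
  exists_algebra_iso_commaObj M hP Z.hom
    (fun G hG ↦ (bijective_commaUnitHom_iff M G Z.hom).1
      (hZ _ (commaHoms_commaUnitHom M hG)))
    (fun _ hG ↦ exists_of_surjective_commaMulHom M Z.hom
      (hZ _ (commaHoms_commaMulHom M hG)).2)

end

lemma hasColimits_algebra {C : Type u} [Category.{v} C] (M : Monad C) (κ : Cardinal.{v})
    [Fact κ.IsRegular] [IsCardinalLocallyPresentable C κ] [M.toFunctor.IsCardinalAccessible κ] :
    HasColimits M.Algebra := by
  obtain ⟨P, _, hP⟩ := HasCardinalFilteredGenerator.exists_small_generator C κ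
  have (X : C) : IsPresentable.{v} X := hP.presentable X
  obtain ⟨κ', _, hκ', hX⟩ := exists_isCardinalPresentable κ
    (fun i : Subtype P × Fin 6 ↦ (![⊥_ C, M.obj (⊥_ C), M.obj (⊥_ C) ⨿ i.1.1, i.1.1,
      M.obj i.1.1, M.obj (M.obj i.1.1)] : Fin 6 → C) i.2)
  have := M.toFunctor.isCardinalAccessible_of_le hκ'
  have hobj {X Y : C} (y : M.obj X ⟶ Y) (_ : IsCardinalPresentable X κ')
      (_ : IsCardinalPresentable Y κ') (_ : IsCardinalPresentable (M.obj X) κ') :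
      IsCardinalPresentable (commaObj M y) κ' :=
    comma_isCardinalPresentable κ' _
  have : HasColimits (Comma M.toFunctor (𝟭 C)) := ⟨fun _ _ ↦ comma_hasColimitsOfShape _⟩
  have : (commaHoms M P).isLocal.ι.IsRightAdjoint :=
    MorphismProperty.isRightAdjoint_ι_isLocal _ κ' <| by
      rintro _ _ _ ⟨G | G⟩
      · exact ⟨hobj _ (hX (G, 0)) (hX (G, 2)) (hX (G, 1)),
          hobj _ (hX (G, 3)) (hX (G, 4)) (hX (G, 4))⟩
      · exact ⟨hobj _ (hX (G, 3)) (hX (G, 4)) (hX (G, 4)),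
          hobj _ (hX (G, 4)) (hX (G, 4)) (hX (G, 5))⟩
  let I := (commaHoms M P).isLocal.lift (algebraToComma M) (isLocal_commaHoms_algebra M P)
  have : I.EssSurj := ⟨fun Z ↦ by
    obtain ⟨A, ⟨e⟩⟩ := exists_algebra_iso_of_isLocal M hP Z.property
    exact ⟨A, ⟨(commaHoms M P).isLocal.isoMk e⟩⟩⟩
  have : I.IsEquivalence := { }
  let _ : Reflective (commaHoms M P).isLocal.ι :=
    { L := _, adj := Adjunction.ofIsRightAdjoint _ }
  have := hasColimits_of_reflective.{v, v} (commaHoms M P).isLocal.ι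
  exact Adjunction.has_colimits_of_equivalence I

/-- A `κ`-accessible monad on a locally `κ`-presentable category has a locally
`κ`-presentable category of Eilenberg–Moore algebras. -/
theorem locallyPresentable_algebras {C : Type u} [Category.{v} C]
    (κ : Cardinal.{v}) (hκ : κ.IsRegular)
    (hC : LocallyKappaPresentable κ C) (M : Monad C)
    (hM : ∀ (J : Type v) (_ : SmallCategory J), KappaFiltered κ J →
      Nonempty (PreservesColimitsOfShape J M.toFunctor)) :
    LocallyKappaPresentable κ (Monad.Algebra M) := by
  have : Fact κ.IsRegular := ⟨hκ⟩
  have := (locallyKappaPresentable_iff κ C).1 hC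
  have : M.toFunctor.IsCardinalAccessible κ :=
    ⟨fun J _ hJ ↦ (hM J _ ((kappaFiltered_iff κ J).2 hJ)).some⟩
  have := hasColimits_algebra M κ
  exact (locallyKappaPresentable_iff κ M.Algebra).2
    (algebra_isCardinalLocallyPresentable_of_hasColimits κ M)
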